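/- arXiv:2507.00941 — 2 statements merged into one kernel-verified Lean document; each statement's English description precedes it below -/
import Mathlib

section
/- For all positive integers l, k and d, there exists a finite connected simple graph G with diameter at least d such that cop_l(G) - cop'_l(G) ≥ k. -/
open Classical

/-- A cop at `c` sees the vertex `v` when `v` is within distance `l` of `c`. -/
def inSight {V : Type} (G : SimpleGraph V) (l : ℕ) (c v : V) : Prop :=
  G.Reachable c v ∧ G.dist c v ≤ l

/-- A legal robber trajectory: at each turn the robber stays put or moves
to an adjacent vertex. -/
def LegalRobber {V : Type} (G : SimpleGraph V) (r : ℕ → V) : Prop :=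
  ∀ t, r (t + 1) = r t ∨ G.Adj (r t) (r (t + 1))

/-- A legal sequence of cop positions: at each turn every cop stays put or
moves to an adjacent vertex. -/
def LegalCopPath {V : Type} (G : SimpleGraph V) {k : ℕ} (P : ℕ → Fin k → V) : Prop :=
  ∀ t i, P (t + 1) i = P t i ∨ G.Adj (P t i) (P (t + 1) i)

/-- The observation made by `l`-visibility cops at positions `P` when the robber
is at `rv`: they see the robber exactly when he is within distance `l` of some cop. -/
noncomputable def visObs {V : Type} (G : SimpleGraph V) (l : ℕ) {k : ℕ}
    (P : Fin k → V) (rv : V) : Option V :=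
  if ∃ i, inSight G l (P i) rv then some rv else none

/-- The play of the `l`-visibility game: given initial cop positions `init`, a cop
strategy `σ` (a function of the history of observations only), and a robber
trajectory `r`, this returns the cop positions after `t` cop moves together with the
history of observations made so far. -/
noncomputable def visPlay {V : Type} (G : SimpleGraph V) (l : ℕ) {k : ℕ}
    (init : Fin k → V) (σ : List (Option V) → Fin k → V) (r : ℕ → V) :
    ℕ → (Fin k → V) × List (Option V)
  | 0 => (init, [])
  | t + 1 =>
    let prev := visPlay G l init σ r t
    let h := prev.2 ++ [visObs G l prev.1 (r t)]
    (σ h, h)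

/-- Cop positions after `t` cop moves in the `l`-visibility game. -/
noncomputable def visPos {V : Type} (G : SimpleGraph V) (l : ℕ) {k : ℕ}
    (init : Fin k → V) (σ : List (Option V) → Fin k → V) (r : ℕ → V) (t : ℕ) :
    Fin k → V :=
  (visPlay G l init σ r t).1

/-- `k` cops with visibility `l` can guarantee capturing the robber on `G`:
there are initial positions and a strategy (depending only on the cops' observations)
whose moves are always legal and such that, against every legal robber trajectory,
some cop eventually occupies the robber's vertex. -/
def VisCopsCapture {V : Type} (G : SimpleGraph V) (l k : ℕ) : Prop :=
  ∃ (init : Fin k → V) (σ : List (Option V) → Fin k → V),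
    ∀ r : ℕ → V, LegalRobber G r →
      LegalCopPath G (visPos G l init σ r) ∧
      ∃ t i, visPos G l init σ r t i = r t ∨ visPos G l init σ r (t + 1) i = r t

/-- `k` cops with visibility `l` can guarantee seeing the robber on `G`. -/
def VisCopsSee {V : Type} (G : SimpleGraph V) (l k : ℕ) : Prop :=
  ∃ (init : Fin k → V) (σ : List (Option V) → Fin k → V),
    ∀ r : ℕ → V, LegalRobber G r →
      LegalCopPath G (visPos G l init σ r) ∧
      ∃ t i, inSight G l (visPos G l init σ r t i) (r t) ∨
        inSight G l (visPos G l init σ r (t + 1) i) (r t)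

/-- The `l`-visibility capture number `cop_l(G)`. -/
noncomputable def visCaptureNum {V : Type} (G : SimpleGraph V) (l : ℕ) : ℕ :=
  sInf {k | VisCopsCapture G l k}

/-- The `l`-visibility seeing number `cop'_l(G)`. -/
noncomputable def visSeeNum {V : Type} (G : SimpleGraph V) (l : ℕ) : ℕ :=
  sInf {k | VisCopsSee G l k}
/-- If the robber has a set `core` of vertices in which he can always find a place that `k` cops
do not threaten, both initially and after every cop move, then `k` cops cannot capture him,
whatever their visibility is. -/
lemma not_visCopsCapture {V : Type} (G : SimpleGraph V) (l k : ℕ) (core : Set V)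
    (start : ∀ P : Fin k → V, ∃ w ∈ core, ∀ i, P i ≠ w ∧ ¬ G.Adj (P i) w)
    (step : ∀ u ∈ core, ∀ P : Fin k → V, (∀ i, P i ≠ u) →
      ∃ w ∈ core, (w = u ∨ G.Adj u w) ∧ ∀ i, P i ≠ w ∧ ¬ G.Adj (P i) w) :
    ¬ VisCopsCapture G l k := by
  rintro ⟨init, σ, hσ⟩
  have hnext : ∀ (u : V) (P : Fin k → V), ∃ w, (w = u ∨ G.Adj u w) ∧
      (u ∈ core → (∀ i, P i ≠ u) → w ∈ core ∧ ∀ i, P i ≠ w ∧ ¬ G.Adj (P i) w) := by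
    intro u P
    by_cases h : u ∈ core ∧ ∀ i, P i ≠ u
    · obtain ⟨w, hw, h1, h2⟩ := step u h.1 P h.2
      exact ⟨w, h1, fun _ _ => ⟨hw, h2⟩⟩
    · exact ⟨u, Or.inl rfl, fun h1 h2 => absurd ⟨h1, h2⟩ h⟩
  choose next hmove hsafe using hnext
  obtain ⟨r₀, hr₀, hr₀'⟩ := start init
  let play : ℕ → ((Fin k → V) × List (Option V)) × V := fun t =>
    Nat.rec ((init, []), r₀) (fun _ prev =>
      let h := prev.1.2 ++ [visObs G l prev.1.1 prev.2]
      ((σ h, h), next prev.2 (σ h))) t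
  let r : ℕ → V := fun t => (play t).2
  have hplay : ∀ t, visPlay G l init σ r t = (play t).1 := by
    intro t
    induction t with
    | zero => rfl
    | succ t ih =>
      rw [visPlay, ih]
  have hr : ∀ t, r (t + 1) = next (r t) (visPos G l init σ r (t + 1)) := by
    intro t
    rw [visPos, hplay]
  have hlegal : LegalRobber G r := fun t => by
    rw [hr]
    exact hmove _ _
  obtain ⟨hcop, t, i, ht⟩ := hσ r hlegal
  have havoid : ∀ t, (∀ i, visPos G l init σ r t i ≠ r t ∧
      ¬ G.Adj (visPos G l init σ r t i) (r t)) → ∀ i, visPos G l init σ r (t + 1) i ≠ r t := by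
    intro t h i
    rcases hcop t i with h' | h'
    · rw [h']
      exact (h i).1
    · intro h''
      exact (h i).2 (h'' ▸ h')
  have hinv : ∀ t, r t ∈ core ∧ ∀ i, visPos G l init σ r t i ≠ r t ∧
      ¬ G.Adj (visPos G l init σ r t i) (r t) := by
    intro t
    induction t with
    | zero => exact ⟨hr₀, hr₀'⟩
    | succ t ih =>
      rw [hr]
      exact hsafe _ _ ih.1 (havoid t ih.2)
  rcases ht with ht | ht
  · exact ((hinv t).2 i).1 ht
  · exact havoid t (hinv t).2 i ht

/-- Placing a cop on every vertex captures the robber. -/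
lemma exists_visCopsCapture {V : Type} [Fintype V] (G : SimpleGraph V) (l : ℕ) :
    ∃ k, VisCopsCapture G l k := by
  let e := (Fintype.equivFin V).symm
  refine ⟨Fintype.card V, e, fun _ => e, fun r _ => ⟨?_, 0, e.symm (r 0), Or.inl ?_⟩⟩
  · rintro (_ | t) i <;> exact Or.inl rfl
  · exact e.apply_symm_apply _

/-- Cops that move once, from `P` to `Q`, see the robber if the closed neighbourhoods of `P`
and `Q` cover the graph. -/
lemma visCopsSee_of_cover {V : Type} (G : SimpleGraph V) {l k : ℕ} (hl : 0 < l)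
    (P Q : Fin k → V) (hPQ : ∀ i, Q i = P i ∨ G.Adj (P i) (Q i))
    (hcover : ∀ v, ∃ i, (P i = v ∨ G.Adj (P i) v) ∨ (Q i = v ∨ G.Adj (Q i) v)) :
    VisCopsSee G l k := by
  have hsight : ∀ c v, c = v ∨ G.Adj c v → inSight G l c v := by
    rintro c v (rfl | h)
    · exact ⟨SimpleGraph.Reachable.refl _, by simp⟩
    · exact ⟨h.reachable, by rw [SimpleGraph.dist_eq_one_iff_adj.2 h]; exact hl⟩
  refine ⟨P, fun _ => Q, fun r _ => ⟨?_, ?_⟩⟩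
  · rintro (_ | t) i
    · exact hPQ i
    · exact Or.inl rfl
  · obtain ⟨i, hi⟩ := hcover (r 0)
    exact ⟨0, i, hi.imp (hsight _ _) (hsight _ _)⟩

/-- A function to `ℕ` that increases by at most one along edges bounds distances from below. -/
lemma le_add_dist_of_adj_le {V : Type} {G : SimpleGraph V} (hG : G.Connected) (f : V → ℕ)
    (hf : ∀ u v, G.Adj u v → f v ≤ f u + 1) (u v : V) : f v ≤ f u + G.dist u v := by
  obtain ⟨w, hw⟩ := hG.exists_walk_length_eq_dist u v
  rw [← hw]
  clear hw
  induction w with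
  | nil => simp
  | cons h _ ih =>
    have := hf _ _ h
    rw [SimpleGraph.Walk.length_cons]
    omega

/-- Vertices of the graph `hubGraph`: hubs, core vertices grouped under the hubs, and a tail. -/
abbrev HubVertex (s n p d : ℕ) : Type :=
  (Fin s × Bool) ⊕ (((Fin s × Bool) × Fin n) × ZMod p) ⊕ Fin (d + 1)

/-- Adjacency in `hubGraph`. -/
def hubAdj {s n p d : ℕ} (φ : (Fin s × Bool) × Fin n → ZMod p) (a₀ : Fin s × Bool) :
    HubVertex s n p d → HubVertex s n p d → Prop
  | .inl a, .inl b => a.1 = b.1 ∧ a ≠ b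
  | .inl a, .inr (.inl x) => x.1.1 = a
  | .inr (.inl x), .inl a => x.1.1 = a
  | .inr (.inl x), .inr (.inl y) => x ≠ y ∧ x.2 + y.2 = φ x.1 * φ y.1
  | .inr (.inr i), .inr (.inr j) => i.val + 1 = j.val ∨ j.val + 1 = i.val
  | .inl a, .inr (.inr i) => i.val = 0 ∧ a = a₀
  | .inr (.inr i), .inl a => i.val = 0 ∧ a = a₀
  | .inr (.inl _), .inr (.inr _) => False
  | .inr (.inr _), .inr (.inl _) => False

/-- A graph consisting of `s` pairs of adjacent hubs, a polarity graph on the core each of whose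
vertices is joined to the hub of its group, and a tail of length `d` attached to `a₀`. -/
def hubGraph {s n p : ℕ} (d : ℕ) (φ : (Fin s × Bool) × Fin n → ZMod p) (a₀ : Fin s × Bool) :
    SimpleGraph (HubVertex s n p d) where
  Adj := hubAdj φ a₀
  symm := ⟨by
    rintro (a | x | i) (b | y | j) h <;> simp only [hubAdj] at h ⊢
    · exact ⟨h.1.symm, h.2.symm⟩
    all_goals try exact h
    · exact ⟨h.1.symm, by rw [add_comm, h.2, mul_comm]⟩
    · exact h.symm⟩
  loopless := ⟨by
    rintro (a | x | i) h <;> simp [hubAdj] at h⟩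

section HubGraph

variable {s n p d : ℕ} {φ : (Fin s × Bool) × Fin n → ZMod p} {a₀ : Fin s × Bool}

lemma hubGraph_adj {u v : HubVertex s n p d} :
    (hubGraph d φ a₀).Adj u v ↔ hubAdj φ a₀ u v := Iff.rfl

/-- The vertex of group `a` and index `m` that is equal or adjacent to the core vertex `x`. -/
def coreNeighbor (φ : (Fin s × Bool) × Fin n → ZMod p) (x : ((Fin s × Bool) × Fin n) × ZMod p)
    (a : Fin s × Bool) (m : Fin n) : ((Fin s × Bool) × Fin n) × ZMod p :=
  ((a, m), φ x.1 * φ (a, m) - x.2)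

lemma coreNeighbor_eq_or_adj (x : ((Fin s × Bool) × Fin n) × ZMod p) (a : Fin s × Bool)
    (m : Fin n) : coreNeighbor φ x a m = x ∨
      (hubGraph d φ a₀).Adj (.inr (.inl x)) (.inr (.inl (coreNeighbor φ x a m))) := by
  by_cases h : coreNeighbor φ x a m = x
  · exact Or.inl h
  · exact Or.inr ⟨Ne.symm h, by simp [coreNeighbor]⟩

lemma hubGraph_connected (hn : 0 < n) : (hubGraph d φ a₀).Connected := by
  have hcore : ∀ x, (hubGraph d φ a₀).Reachable (.inr (.inl x)) (.inl a₀) := by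
    intro x
    have h1 : (hubGraph d φ a₀).Reachable (.inr (.inl (coreNeighbor φ x a₀ ⟨0, hn⟩)))
        (.inl a₀) :=
      SimpleGraph.Adj.reachable (hubGraph_adj.2 rfl)
    rcases coreNeighbor_eq_or_adj (d := d) (φ := φ) (a₀ := a₀) x a₀ ⟨0, hn⟩ with h | h
    · rwa [h] at h1
    · exact h.reachable.trans h1
  have htail : ∀ i (hi : i < d + 1),
      (hubGraph d φ a₀).Reachable (.inr (.inr ⟨i, hi⟩)) (.inl a₀) := by
    intro i
    induction i with
    | zero => exact fun hi => SimpleGraph.Adj.reachable (hubGraph_adj.2 ⟨rfl, rfl⟩)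
    | succ i ih =>
      intro hi
      exact (SimpleGraph.Adj.reachable (hubGraph_adj.2 (by simp [hubAdj]))).trans
        (ih (Nat.lt_of_succ_lt hi))
  have hall : ∀ v, (hubGraph d φ a₀).Reachable v (.inl a₀) := by
    rintro (a | x | i)
    · have h : (hubGraph d φ a₀).Adj (.inl a) (.inr (.inl ((a, ⟨0, hn⟩), 0))) :=
        hubGraph_adj.2 rfl
      exact h.reachable.trans (hcore _)
    · exact hcore x
    · exact htail i.1 i.2
  have : Nonempty (HubVertex s n p d) := ⟨.inl a₀⟩
  exact ⟨fun u v => (hall u).trans (hall v).symm⟩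

lemma le_diam_hubGraph [NeZero p] (hn : 0 < n) : d ≤ (hubGraph d φ a₀).diam := by
  have hG : (hubGraph d φ a₀).Connected := hubGraph_connected hn
  let f : HubVertex s n p d → ℕ := Sum.elim (fun _ => 0) (Sum.elim (fun _ => 0) (fun i => i.val))
  have h := le_add_dist_of_adj_le hG f (by
    rintro (a | x | i) (b | y | j) h <;> rw [hubGraph_adj] at h <;>
      simp only [hubAdj] at h <;> simp [f] <;> omega) (.inr (.inr 0)) (.inr (.inr (Fin.last d)))
  have : Nonempty (HubVertex s n p d) := ⟨.inl a₀⟩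
  have h2 := SimpleGraph.dist_le_diam (SimpleGraph.connected_iff_ediam_ne_top.1 hG)
    (u := .inr (.inr 0)) (v := .inr (.inr (Fin.last d)))
  simp only [f, Sum.elim_inr, Fin.val_zero, Fin.val_last] at h
  omega

lemma visCopsSee_hubGraph {l : ℕ} (hl : 0 < l) :
    VisCopsSee (hubGraph d φ a₀) l (s + (d + 1)) := by
  let P (b : Bool) : Fin (s + (d + 1)) → HubVertex s n p d := fun i =>
    Sum.elim (fun j => .inl (j, b)) (fun j => .inr (.inr j)) (finSumFinEquiv.symm i)
  refine visCopsSee_of_cover _ hl (P false) (P true) ?_ ?_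
  · intro i
    obtain ⟨i, rfl⟩ := finSumFinEquiv.surjective i
    rcases i with i | i
    · exact Or.inr (by simp [P, hubGraph, hubAdj])
    · exact Or.inl (by simp [P])
  · rintro (⟨j, _ | _⟩ | ⟨⟨⟨j, _ | _⟩, m⟩, c⟩ | i)
    · exact ⟨finSumFinEquiv (.inl j), by simp [P]⟩
    · exact ⟨finSumFinEquiv (.inl j), by simp [P]⟩
    · exact ⟨finSumFinEquiv (.inl j), by simp [P, hubGraph, hubAdj]⟩
    · exact ⟨finSumFinEquiv (.inl j), by simp [P, hubGraph, hubAdj]⟩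
    · exact ⟨finSumFinEquiv (.inr i), by simp [P]⟩

/-- A vertex other than `x` and the hub `a` is equal or adjacent to at most two of the vertices
`coreNeighbor φ x a m`. -/
lemma card_threatened_le [Fact p.Prime] (hφ : Function.Injective φ)
    (x : ((Fin s × Bool) × Fin n) × ZMod p) (a : Fin s × Bool) (c : HubVertex s n p d)
    (hx : c ≠ .inr (.inl x)) (ha : c ≠ .inl a) :
    (Finset.univ.filter fun m => c = .inr (.inl (coreNeighbor φ x a m)) ∨
      (hubGraph d φ a₀).Adj c (.inr (.inl (coreNeighbor φ x a m)))).card ≤ 2 := by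
  rw [Finset.filter_or]
  refine (Finset.card_union_le _ _).trans (Nat.add_le_add (b := 1) (d := 1) ?_ ?_) <;>
    rw [Finset.card_le_one] <;> intro m hm m' hm' <;>
    simp only [Finset.mem_filter, Finset.mem_univ, true_and] at hm hm'
  · rw [hm] at hm'
    simp only [coreNeighbor, Sum.inr.injEq, Sum.inl.injEq, Prod.mk.injEq, true_and] at hm'
    exact hm'.1
  · rw [hubGraph_adj] at hm hm'
    rcases c with b | y | i
    · exact absurd (congrArg Sum.inl hm).symm ha
    · have h1 := hm.2
      have h2 := hm'.2
      simp only [coreNeighbor] at h1 h2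
      have hy : φ x.1 - φ y.1 ≠ 0 := by
        intro h0
        rw [sub_eq_zero] at h0
        refine hx (congrArg (Sum.inr ∘ Sum.inl) (Prod.ext (hφ h0).symm ?_))
        rw [h0] at h1
        linear_combination h1
      have h3 : φ (a, m) = φ (a, m') := by
        apply mul_left_cancel₀ hy
        linear_combination h1 - h2
      exact (Prod.ext_iff.1 (hφ h3)).2
    · exact hm.elim

/-- Fewer than `2 * s` cops leave some vertex near the core vertex `x` unthreatened. -/
lemma exists_safe_coreNeighbor [Fact p.Prime] (hφ : Function.Injective φ) {k : ℕ}
    (hk : k < 2 * s) (hkn : k * 2 < n) (x : ((Fin s × Bool) × Fin n) × ZMod p)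
    (P : Fin k → HubVertex s n p d) (hP : ∀ i, P i ≠ .inr (.inl x)) :
    ∃ a m, ∀ i, P i ≠ .inr (.inl (coreNeighbor φ x a m)) ∧
      ¬ (hubGraph d φ a₀).Adj (P i) (.inr (.inl (coreNeighbor φ x a m))) := by
  obtain ⟨a, ha⟩ : ∃ a : Fin s × Bool, ∀ i, P i ≠ .inl a := by
    by_contra! h
    choose g hg using h
    have hinj : Function.Injective g := fun a b hab =>
      Sum.inl_injective ((hg a).symm.trans (hab ▸ hg b))
    have := Fintype.card_le_of_injective g hinj
    simp only [Fintype.card_prod, Fintype.card_fin, Fintype.card_bool] at this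
    omega
  refine ⟨a, ?_⟩
  by_contra! h
  have hcard := Finset.card_biUnion_le_card_mul Finset.univ (fun i : Fin k =>
    Finset.univ.filter fun m => P i = .inr (.inl (coreNeighbor φ x a m)) ∨
      (hubGraph d φ a₀).Adj (P i) (.inr (.inl (coreNeighbor φ x a m)))) 2
    (fun i _ => card_threatened_le hφ x a (P i) (hP i) (ha i))
  rw [Finset.eq_univ_of_forall (s := Finset.biUnion _ _)] at hcard
  · simp only [Finset.card_univ, Fintype.card_fin] at hcard
    omega
  · intro m
    obtain ⟨i, hi⟩ := h m
    simp only [Finset.mem_biUnion, Finset.mem_filter, Finset.mem_univ, true_and]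
    exact ⟨i, or_iff_not_imp_left.2 hi⟩

lemma not_visCopsCapture_hubGraph [Fact p.Prime] (hφ : Function.Injective φ) {k : ℕ} (l : ℕ)
    (hk : k < 2 * s) (hkn : k * 2 < n) : ¬ VisCopsCapture (hubGraph d φ a₀) l k := by
  have hnear : ∀ x, ∀ P : Fin k → HubVertex s n p d, (∀ i, P i ≠ .inr (.inl x)) →
      ∃ y : ((Fin s × Bool) × Fin n) × ZMod p,
        (Sum.inr (Sum.inl y) = (Sum.inr (Sum.inl x) : HubVertex s n p d) ∨
          (hubGraph d φ a₀).Adj (.inr (.inl x)) (.inr (.inl y))) ∧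
        ∀ i, P i ≠ .inr (.inl y) ∧ ¬ (hubGraph d φ a₀).Adj (P i) (.inr (.inl y)) := by
    intro x P hP
    obtain ⟨a, m, h⟩ := exists_safe_coreNeighbor (a₀ := a₀) hφ hk hkn x P hP
    exact ⟨coreNeighbor φ x a m, (coreNeighbor_eq_or_adj x a m).imp_left (fun h => by rw [h]), h⟩
  refine not_visCopsCapture _ l k (Set.range fun x => .inr (.inl x)) ?_ ?_
  · intro P
    obtain ⟨m, hm⟩ : ∃ m : Fin n, ∀ i, P i ≠ .inr (.inl ((a₀, m), 0)) := by
      by_contra! h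
      choose g hg using h
      have hinj : Function.Injective g := fun m m' hab => by
        have h := hg m
        rw [hab, hg m'] at h
        simpa using h.symm
      have := Fintype.card_le_of_injective g hinj
      simp only [Fintype.card_fin] at this
      omega
    obtain ⟨y, -, hy⟩ := hnear _ P hm
    exact ⟨_, ⟨y, rfl⟩, hy⟩
  · rintro _ ⟨x, rfl⟩ P hP
    obtain ⟨y, hxy, hy⟩ := hnear x P hP
    exact ⟨_, ⟨y, rfl⟩, hxy, hy⟩

end HubGraph

/-- For all positive integers `l`, `k` and `d`, there exists a finite
connected simple graph `G` with diameter at least `d` such that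
`cop_l(G) - cop'_l(G) ≥ k`. -/
theorem cost_of_capture_large_diameter (l k d : ℕ) (hl : 0 < l) (hk : 0 < k)
    (hd : 0 < d) :
    ∃ (V : Type) (_ : Fintype V) (G : SimpleGraph V),
      G.Connected ∧ d ≤ G.diam ∧ visSeeNum G l + k ≤ visCaptureNum G l := by
  obtain ⟨s, hs⟩ : ∃ s, s = d + 1 + k := ⟨_, rfl⟩
  obtain ⟨p, hp, hprime⟩ := Nat.exists_infinite_primes (2 * s * (4 * s))
  have : Fact p.Prime := ⟨hprime⟩
  obtain ⟨φ⟩ : Nonempty ((Fin s × Bool) × Fin (4 * s) ↪ ZMod p) := by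
    rw [Function.Embedding.nonempty_iff_card_le]
    simp only [Fintype.card_prod, Fintype.card_fin, Fintype.card_bool, ZMod.card]
    linarith
  let a₀ : Fin s × Bool := (⟨0, by omega⟩, false)
  refine ⟨HubVertex s (4 * s) p d, inferInstance, hubGraph d φ a₀,
    hubGraph_connected (by omega), le_diam_hubGraph (by omega), ?_⟩
  have hsee : visSeeNum (hubGraph d φ a₀) l ≤ s + (d + 1) :=
    Nat.sInf_le (visCopsSee_hubGraph hl)
  have hcapture : 2 * s ≤ visCaptureNum (hubGraph d φ a₀) l := by
    refine le_csInf (exists_visCopsCapture _ l) fun m hm => ?_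
    by_contra! h
    exact not_visCopsCapture_hubGraph φ.injective l h (by omega) hm
  omega
end

section
/- Two cleaners with 1-visibility cannot clean the Heawood graph of all gas; that is, cop'_1(H) ≥ 3 where H is the Heawood graph. -/
open Classical

/-- The set of vertices not in the closed `l`-neighbourhood of any of the
cleaners at positions `P`. -/
def unseen {V : Type} (G : SimpleGraph V) (l : ℕ) {k : ℕ} (P : Fin k → V) : Set V :=
  {v | ∀ i, ¬ inSight G l (P i) v}

/-- One round of the cleaning process, performed with the cleaners standing at their
new positions `P`: first every vertex within distance `l` of a cleaner is cleaned,
and then the gas spreads from the remaining gaseous vertices to every adjacent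
vertex that is not within distance `l` of a cleaner. -/
def gasStep {V : Type} (G : SimpleGraph V) (l : ℕ) {k : ℕ} (P : Fin k → V)
    (S : Set V) : Set V :=
  (S ∩ unseen G l P) ∪ {v ∈ unseen G l P | ∃ u ∈ S ∩ unseen G l P, G.Adj u v}

/-- A legal sequence of cleaner positions: at each timestep every cleaner stays put
or moves to an adjacent vertex. -/
def ValidMoves {V : Type} (G : SimpleGraph V) {k : ℕ} (pos : ℕ → Fin k → V) : Prop :=
  ∀ t i, pos (t + 1) i = pos t i ∨ G.Adj (pos t i) (pos (t + 1) i)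

/-- The set of gaseous vertices after `t` full rounds (move, clean, spread) of the
cleaning process with `l`-visibility cleaners following the position sequence `pos`.
Initially every vertex not within distance `l` of a cleaner is gaseous. -/
def gasSeq {V : Type} (G : SimpleGraph V) (l : ℕ) {k : ℕ} (pos : ℕ → Fin k → V) :
    ℕ → Set V
  | 0 => unseen G l (pos 0)
  | t + 1 => gasStep G l (pos (t + 1)) (gasSeq G l pos t)

/-- The set of gaseous vertices in round `t + 1` at the intermediate moment after the
cleaners have moved and cleaned, but before the gas spreads. -/
def gasMid {V : Type} (G : SimpleGraph V) (l : ℕ) {k : ℕ} (pos : ℕ → Fin k → V)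
    (t : ℕ) : Set V :=
  gasSeq G l pos t ∩ unseen G l (pos (t + 1))

/-- `k` cleaners with `l`-visibility have a strategy such that at some point during
the cleaning process on `G` at most `r` vertices are gaseous. -/
def CanCleanDownTo {V : Type} (G : SimpleGraph V) (l k r : ℕ) : Prop :=
  ∃ pos : ℕ → Fin k → V, ValidMoves G pos ∧
    ∃ t, (gasSeq G l pos t).ncard ≤ r ∨ (gasMid G l pos t).ncard ≤ r

/-- The `(r, l)`-inference number `ded^r_l(G)`: the minimum number of cleaners with
`l`-visibility that can reach a state of the cleaning process with at most `r`
gaseous vertices. -/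
noncomputable def dedNum {V : Type} (G : SimpleGraph V) (r l : ℕ) : ℕ :=
  sInf {k | CanCleanDownTo G l k r}

/-- `k` cleaners with `l`-visibility have a strategy cleaning `G` of all gas. -/
def CanCleanAll {V : Type} (G : SimpleGraph V) (l k : ℕ) : Prop :=
  ∃ pos : ℕ → Fin k → V, ValidMoves G pos ∧
    ∃ t, gasSeq G l pos t = ∅ ∨ gasMid G l pos t = ∅

/-- The `l`-visibility seeing number `cop'_l(G)`: the minimum number of cleaners with
`l`-visibility that can clean `G` of all gas. -/
noncomputable def seeNum {V : Type} (G : SimpleGraph V) (l : ℕ) : ℕ :=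
  sInf {k | CanCleanAll G l k}

/-- `k` cleaners with `l`-visibility have a strategy such that at some point during
the cleaning process on `G` at least `N` vertices are clean (a vertex being clean
precisely when it is not gaseous). -/
def CanCleanAtLeast {V : Type} (G : SimpleGraph V) (l k N : ℕ) : Prop :=
  ∃ pos : ℕ → Fin k → V, ValidMoves G pos ∧
    ∃ t, N ≤ ((gasSeq G l pos t)ᶜ).ncard ∨ N ≤ ((gasMid G l pos t)ᶜ).ncard

/-- `Δ_l(H)`: the maximum over the vertices `v` of `H` of the number of vertices
distinct from `v` at distance at most `l` from `v`. -/
noncomputable def maxBall {W : Type} (H : SimpleGraph W) (l : ℕ) : ℕ :=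
  ⨆ v : W, {u | u ≠ v ∧ H.Reachable v u ∧ H.dist v u ≤ l}.ncard

/-- The Heawood graph: the cubic graph on 14 vertices with LCF notation `[5,-5]⁷`
(equivalently, the point-line incidence graph of the Fano plane). -/
def heawoodGraph : SimpleGraph (Fin 14) :=
  SimpleGraph.fromRel (fun a b => b = a + 1 ∨ (a.val % 2 = 0 ∧ b = a + 5))

theorem inSight_one_iff {V : Type} (G : SimpleGraph V) (c v : V) :
    inSight G 1 c v ↔ c = v ∨ G.Adj c v := by
  constructor
  · rintro ⟨hr, hd⟩
    rcases Nat.le_one_iff_eq_zero_or_eq_one.mp hd with h | h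
    · exact Or.inl (hr.dist_eq_zero_iff.mp h)
    · exact Or.inr (SimpleGraph.dist_eq_one_iff_adj.mp h)
  · rintro (rfl | h)
    · exact ⟨SimpleGraph.Reachable.rfl, by simp⟩
    · exact ⟨h.reachable, (SimpleGraph.dist_eq_one_iff_adj.mpr h).le⟩

theorem mem_unseen_one_iff {V : Type} (G : SimpleGraph V) {k : ℕ} (P : Fin k → V) (v : V) :
    v ∈ unseen G 1 P ↔ ∀ i, P i ≠ v ∧ ¬ G.Adj (P i) v := by
  simp [unseen, inSight_one_iff]

theorem gasSeq_subset_unseen {V : Type} (G : SimpleGraph V) (l : ℕ) {k : ℕ}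
    (pos : ℕ → Fin k → V) (t : ℕ) : gasSeq G l pos t ⊆ unseen G l (pos t) := by
  cases t with
  | zero => exact subset_rfl
  | succ t => exact Set.union_subset Set.inter_subset_right (Set.sep_subset _ _)

/-- If every newly unseen vertex always has a neighbour that no cleaner sees before or after
the move, then the gas fills every unseen vertex at all times. -/
theorem gasSeq_eq_unseen {V : Type} {G : SimpleGraph V} {l k : ℕ} {pos : ℕ → Fin k → V}
    (h : ∀ t, ∀ v ∈ unseen G l (pos (t + 1)), v ∉ unseen G l (pos t) →
      ∃ u ∈ unseen G l (pos t) ∩ unseen G l (pos (t + 1)), G.Adj u v) (t : ℕ) :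
    gasSeq G l pos t = unseen G l (pos t) := by
  induction t with
  | zero => rfl
  | succ t ih =>
    refine (gasSeq_subset_unseen G l pos (t + 1)).antisymm fun v hv => ?_
    rw [gasSeq, ih]
    by_cases hv' : v ∈ unseen G l (pos t)
    · exact Or.inl ⟨hv', hv⟩
    · exact Or.inr ⟨hv, h t v hv hv'⟩

theorem canCleanAll_card {V : Type} [Fintype V] (G : SimpleGraph V) (l : ℕ) :
    CanCleanAll G l (Fintype.card V) := by
  refine ⟨fun _ => (Fintype.equivFin V).symm, fun _ _ => Or.inl rfl, 0, Or.inl ?_⟩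
  refine Set.eq_empty_of_forall_notMem fun v hv => hv (Fintype.equivFin V v) ?_
  simp [inSight]

theorem heawoodGraph_adj_iff (a b : Fin 14) : heawoodGraph.Adj a b ↔
    a ≠ b ∧ ((b = a + 1 ∨ (a.val % 2 = 0 ∧ b = a + 5)) ∨
      (a = b + 1 ∨ (b.val % 2 = 0 ∧ a = b + 5))) := by
  simp [heawoodGraph, SimpleGraph.fromRel_adj]

instance : DecidableRel heawoodGraph.Adj :=
  fun a b => decidable_of_iff _ (heawoodGraph_adj_iff a b).symm

theorem heawoodGraph_bipartite {a b : Fin 14} (h : heawoodGraph.Adj a b) :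
    a.val % 2 ≠ b.val % 2 := by
  revert a b
  decide +kernel

theorem heawoodGraph_eq_of_common_adj {a b u w : Fin 14} (hab : a ≠ b)
    (hua : heawoodGraph.Adj u a) (hub : heawoodGraph.Adj u b)
    (hwa : heawoodGraph.Adj w a) (hwb : heawoodGraph.Adj w b) : u = w := by
  revert a b u w
  decide +kernel

theorem heawoodGraph_exists_two_other_adj {v p : Fin 14} (h : heawoodGraph.Adj v p) :
    ∃ a b, a ≠ b ∧ a ≠ p ∧ b ≠ p ∧ heawoodGraph.Adj v a ∧ heawoodGraph.Adj v b := by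
  revert v p
  decide +kernel

theorem heawoodGraph_exists_unseen (p q : Fin 14) :
    ∃ v, (p ≠ v ∧ ¬ heawoodGraph.Adj p v) ∧ (q ≠ v ∧ ¬ heawoodGraph.Adj q v) := by
  revert p q
  decide +kernel

/-- A vertex of the Heawood graph that leaves the sight of two moving cleaners has a neighbour
that neither of them sees before or after the move. -/
theorem heawoodGraph_exists_adj_unseen {p p' q q' v : Fin 14}
    (hp : p' = p ∨ heawoodGraph.Adj p p') (hq : q' = q ∨ heawoodGraph.Adj q q')
    (hv : p = v ∨ heawoodGraph.Adj p v)
    (hp' : p' ≠ v ∧ ¬ heawoodGraph.Adj p' v) (hq' : q' ≠ v ∧ ¬ heawoodGraph.Adj q' v) :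
    ∃ u, heawoodGraph.Adj u v ∧ ∀ c, c = p ∨ c = p' ∨ c = q ∨ c = q' →
      c ≠ u ∧ ¬ heawoodGraph.Adj c u := by
  have hpv : heawoodGraph.Adj v p := by
    rcases hv with rfl | h
    · rcases hp with h | h
      · exact absurd h hp'.1
      · exact absurd h.symm hp'.2
    · exact h.symm
  obtain ⟨a, b, hab, hap, hbp, hva, hvb⟩ := heawoodGraph_exists_two_other_adj hpv
  have far {u : Fin 14} (hu : heawoodGraph.Adj v u) (hup : u ≠ p) :
      (p ≠ u ∧ ¬ heawoodGraph.Adj p u) ∧ (p' ≠ u ∧ ¬ heawoodGraph.Adj p' u) := by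
    have b1 := heawoodGraph_bipartite hpv
    have b2 := heawoodGraph_bipartite hu
    have hpu : ¬ heawoodGraph.Adj p u := fun h => by
      have := heawoodGraph_bipartite h
      omega
    refine ⟨⟨hup.symm, hpu⟩, ?_, fun h => ?_⟩
    · rintro rfl
      exact hp'.2 hu.symm
    · rcases hp with rfl | hp
      · exact hpu h
      · exact hp'.1 (heawoodGraph_eq_of_common_adj hup h hp.symm hu hpv)
  by_contra! hne
  have seen {u : Fin 14} (hu : heawoodGraph.Adj v u) (hup : u ≠ p) :
      (q = u ∨ heawoodGraph.Adj q u) ∨ heawoodGraph.Adj q' u := by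
    obtain ⟨c, hc, hcu⟩ := hne u hu.symm
    have := far hu hup
    have : q' ≠ u := fun h => hq'.2 (h ▸ hu.symm)
    grind
  have hqv : q ≠ v := by
    rintro rfl
    rcases hq with h | h
    · exact hq'.1 h
    · exact hq'.2 h.symm
  have single {c : Fin 14} (hc : c ≠ v) (ha : heawoodGraph.Adj c a)
      (hb : heawoodGraph.Adj c b) : False :=
    hc (heawoodGraph_eq_of_common_adj hab ha hb hva hvb)
  have hsa := seen hva hap
  have hsb := seen hvb hbp
  have ba := heawoodGraph_bipartite hva
  have bb := heawoodGraph_bipartite hvb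
  have moved {x y : Fin 14} (hx : heawoodGraph.Adj v x) (hy : heawoodGraph.Adj v y)
      (h : q = x ∨ heawoodGraph.Adj q x) (h' : heawoodGraph.Adj q' y) (hxy : x ≠ y) :
      False := by
    have c : ∀ {c}, c ≠ v → heawoodGraph.Adj c x → heawoodGraph.Adj c y → False :=
      fun hc h1 h2 => hc (heawoodGraph_eq_of_common_adj hxy h1 h2 hx hy)
    have bx := heawoodGraph_bipartite hx
    have bY := heawoodGraph_bipartite hy
    have b' := heawoodGraph_bipartite h'
    rcases h with rfl | h
    · rcases hq with rfl | hq
      · omega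
      · exact c hq'.1 hq.symm h'
    · rcases hq with rfl | hq
      · exact c hq'.1 h h'
      · have b1 := heawoodGraph_bipartite h
        have b2 := heawoodGraph_bipartite hq
        omega
  rcases hsa with ha | ha <;> rcases hsb with hb | hb
  · rcases ha with rfl | ha <;> rcases hb with hb | hb
    · exact hab hb
    · have := heawoodGraph_bipartite hb
      omega
    · subst hb
      have := heawoodGraph_bipartite ha
      omega
    · exact single hqv ha hb
  · exact moved hva hvb ha hb hab
  · exact moved hvb hva hb ha hab.symm
  · exact single hq'.1 ha hb

theorem Fin.exists_eq_or_eq_of_lt_three {k : ℕ} (hk : k < 3) (i : Fin k) :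
    ∃ j : Fin k, ∀ m, m = i ∨ m = j := by
  interval_cases k <;> revert i <;> decide

theorem unseen_heawoodGraph_nonempty {k : ℕ} (hk : k < 3) (P : Fin k → Fin 14) :
    (unseen heawoodGraph 1 P).Nonempty := by
  rcases isEmpty_or_nonempty (Fin k) with h | ⟨⟨i⟩⟩
  · exact ⟨0, fun i => h.elim i⟩
  · obtain ⟨j, hj⟩ := Fin.exists_eq_or_eq_of_lt_three hk i
    obtain ⟨v, hi, hj'⟩ := heawoodGraph_exists_unseen (P i) (P j)
    refine ⟨v, (mem_unseen_one_iff _ _ _).mpr fun m => ?_⟩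
    rcases hj m with rfl | rfl <;> assumption

theorem gasSeq_heawoodGraph {k : ℕ} (hk : k < 3) {pos : ℕ → Fin k → Fin 14}
    (hpos : ValidMoves heawoodGraph pos) (t : ℕ) :
    gasSeq heawoodGraph 1 pos t = unseen heawoodGraph 1 (pos t) := by
  refine gasSeq_eq_unseen (fun t v hv hv' => ?_) t
  simp only [Set.mem_inter_iff, mem_unseen_one_iff] at hv hv' ⊢
  push Not at hv'
  obtain ⟨i, hi⟩ := hv'
  obtain ⟨j, hj⟩ := Fin.exists_eq_or_eq_of_lt_three hk i
  obtain ⟨u, huv, hu⟩ := heawoodGraph_exists_adj_unseen (hpos t i) (hpos t j)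
    (or_iff_not_imp_left.mpr hi) (hv i) (hv j)
  refine ⟨u, ⟨fun m => hu _ ?_, fun m => hu _ ?_⟩, huv⟩ <;>
    rcases hj m with rfl | rfl <;> simp

theorem not_canCleanAll_heawoodGraph {k : ℕ} (hk : k < 3) : ¬ CanCleanAll heawoodGraph 1 k := by
  rintro ⟨pos, hpos, t, ht⟩
  have nonempty (s : ℕ) : gasSeq heawoodGraph 1 pos s ≠ ∅ := by
    rw [gasSeq_heawoodGraph hk hpos]
    exact (unseen_heawoodGraph_nonempty hk _).ne_empty
  rcases ht with ht | ht
  · exact nonempty t ht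
  · refine nonempty (t + 1) ?_
    rw [gasMid] at ht
    simp [gasSeq, gasStep, ht]

/-- Two cleaners with `1`-visibility cannot clean the Heawood
graph of all gas: `cop'_1(H) ≥ 3` where `H` is the Heawood graph. -/
theorem heawood_needs_three_cleaners : 3 ≤ seeNum heawoodGraph 1 := by
  refine le_csInf ⟨_, canCleanAll_card heawoodGraph 1⟩ fun k hk => ?_
  by_contra! h
  exact not_canCleanAll_heawoodGraph h hk
end
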